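/- arXiv:1811.03587 — 2 statements merged into one kernel-verified Lean document; each statement's English description precedes it below -/
import Mathlib

section
/- For every r ∈ ℕ and every n ∈ ℕ, the Hermite-based Bernoulli polynomials of order r and the Hermite-based tangent polynomials of order r satisfy _HB_n^{(r)}((x+u)/4, (y+v)/16) = ∑_{k=0}^{n} 2^{−n−k} · C(n,k) · _HT_k^{(r)}(x,y) · _HB_{n−k}^{(r)}(u/2, v/4), as an identity of polynomials in x, y, u, v over ℝ. -/
open PowerSeries Finset

/-- The formal power series `e^{a t}`. -/
noncomputable def expX (a : ℝ) : PowerSeries ℝ :=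
  PowerSeries.mk fun n => a ^ n / n.factorial

/-- The formal power series `e^{a t^2}`. -/
noncomputable def expX2 (a : ℝ) : PowerSeries ℝ :=
  PowerSeries.mk fun n => if 2 ∣ n then a ^ (n / 2) / (n / 2).factorial else 0

/-- The formal power series `e^{x t + y t^2}`. -/
noncomputable def expH (x y : ℝ) : PowerSeries ℝ := expX x * expX2 y

theorem expX_eq_rescale_exp (a : ℝ) : expX a = rescale a (PowerSeries.exp ℝ) := by
  ext n
  simp [expX, PowerSeries.coeff_exp, div_eq_mul_inv]

theorem expX_add (a b : ℝ) : expX (a + b) = expX a * expX b := by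
  simp only [expX_eq_rescale_exp, PowerSeries.exp_mul_exp_eq_exp_add]

theorem expX2_eq_expand (a : ℝ) : expX2 a = PowerSeries.expand 2 two_ne_zero (expX a) := by
  ext n
  simp [expX2, expX, PowerSeries.coeff_expand]

theorem expX2_add (a b : ℝ) : expX2 (a + b) = expX2 a * expX2 b := by
  simp only [expX2_eq_expand, expX_add, map_mul]

theorem expH_add (x u y v : ℝ) : expH (x + u) (y + v) = expH x y * expH u v := by
  simp only [expH, expX_add, expX2_add]
  ring

theorem rescale_expX (c a : ℝ) : rescale c (expX a) = expX (c * a) := by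
  ext n
  simp [expX, mul_pow, mul_div_assoc]

theorem rescale_expX2 (c a : ℝ) : rescale c (expX2 a) = expX2 (c ^ 2 * a) := by
  ext n
  simp only [expX2, PowerSeries.coeff_rescale, PowerSeries.coeff_mk]
  split_ifs with h
  · rw [mul_pow, ← pow_mul, Nat.mul_div_cancel' h, mul_div_assoc]
  · simp

theorem rescale_expH (c x y : ℝ) : rescale c (expH x y) = expH (c * x) (c ^ 2 * y) := by
  simp only [expH, map_mul, rescale_expX, rescale_expX2]

theorem expX_sub_one_ne_zero {a : ℝ} (ha : a ≠ 0) : expX a - 1 ≠ 0 := by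
  intro h
  have h1 := congrArg (PowerSeries.coeff 1) h
  simp [expX, PowerSeries.coeff_one, ha] at h1

/-- Rescaling the variable in the equation which defines the generating function of the
Hermite-based Bernoulli polynomials of order `r`. -/
theorem rescale_mul_expX_sub_one_pow {f : PowerSeries ℝ} {r : ℕ} {x y : ℝ}
    (h : f * (expX 1 - 1) ^ r = PowerSeries.X ^ r * expH x y) (c : ℝ) :
    rescale c f * (expX c - 1) ^ r =
      (PowerSeries.C c * PowerSeries.X) ^ r * expH (c * x) (c ^ 2 * y) := by
  have h1 := congrArg (rescale c) h
  simpa only [map_mul, map_pow, map_sub, map_one, rescale_expX, rescale_expH,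
    PowerSeries.rescale_X, mul_one] using h1

/-- relation between Hermite-based Bernoulli and tangent polynomials of order r:
    `_HB_n^{(r)}((x+u)/4,(y+v)/16) = ∑_k 2^{-n-k} C(n,k) _HT_k^{(r)}(x,y) _HB_{n-k}^{(r)}(u/2,v/4)`. -/
theorem hermite_bernoulli_tangent_relation
    (B : ℕ → ℕ → ℝ → ℝ → ℝ) (HT : ℕ → ℕ → ℝ → ℝ → ℝ)
    (hB : ∀ r : ℕ, ∀ x y : ℝ,
      (PowerSeries.mk fun n => B r n x y / n.factorial) * (expX 1 - 1) ^ r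
        = PowerSeries.X ^ r * expH x y)
    (hHT : ∀ r : ℕ, ∀ x y : ℝ,
      (PowerSeries.mk fun n => HT r n x y / n.factorial) * (expX 2 + 1) ^ r = 2 ^ r * expH x y)
    (r n : ℕ) (x y u v : ℝ) :
    B r n ((x + u) / 4) ((y + v) / 16) =
      ∑ k ∈ Finset.range (n + 1), (2 : ℝ) ^ (-(n : ℤ) - (k : ℤ)) * (n.choose k : ℝ) *
        HT r k x y * B r (n - k) (u / 2) (v / 4) := by
  have key : rescale 4 (PowerSeries.mk fun n => B r n ((x + u) / 4) ((y + v) / 16) / n.factorial) =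
      (PowerSeries.mk fun n => HT r n x y / n.factorial) *
        rescale 2 (PowerSeries.mk fun n => B r n (u / 2) (v / 4) / n.factorial) := by
    refine mul_right_cancel₀ (pow_ne_zero r (expX_sub_one_ne_zero four_ne_zero)) ?_
    have h4 := rescale_mul_expX_sub_one_pow (hB r ((x + u) / 4) ((y + v) / 16)) 4
    have h2 := rescale_mul_expX_sub_one_pow (hB r (u / 2) (v / 4)) 2
    rw [show 4 * ((x + u) / 4) = x + u by ring,
      show (4 : ℝ) ^ 2 * ((y + v) / 16) = y + v by ring, expH_add] at h4
    rw [show 2 * (u / 2) = u by ring, show (2 : ℝ) ^ 2 * (v / 4) = v by ring] at h2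
    have hsq : expX 4 - 1 = (expX 2 + 1) * (expX 2 - 1) := by
      rw [show (4 : ℝ) = 2 + 2 by norm_num, expX_add]
      ring
    have hC : (PowerSeries.C (4 : ℝ) * PowerSeries.X) = 2 * (PowerSeries.C 2 * PowerSeries.X) := by
      rw [show (4 : ℝ) = 2 * 2 by norm_num, map_mul, map_ofNat, mul_assoc]
    rw [h4, hsq, hC, mul_pow, mul_pow _ (expX 2 - 1)]
    linear_combination (-(2 ^ r * expH x y)) * h2 -
      rescale 2 (PowerSeries.mk fun n => B r n (u / 2) (v / 4) / n.factorial) *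
        (expX 2 - 1) ^ r * hHT r x y
  have hn := congrArg (PowerSeries.coeff n) key
  rw [PowerSeries.coeff_mul, Finset.Nat.sum_antidiagonal_eq_sum_range_succ_mk] at hn
  simp only [PowerSeries.coeff_rescale, PowerSeries.coeff_mk] at hn
  have hf : (n.factorial : ℝ) ≠ 0 := by positivity
  have hB' : B r n ((x + u) / 4) ((y + v) / 16) = (n.factorial / 4 ^ n : ℝ) *
      (4 ^ n * (B r n ((x + u) / 4) ((y + v) / 16) / n.factorial)) := by
    field_simp
  rw [hB', hn, Finset.mul_sum]
  refine Finset.sum_congr rfl fun k hk => ?_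
  have hkn : k ≤ n := Nat.lt_succ_iff.mp (Finset.mem_range.mp hk)
  have hpow : (2 : ℝ) ^ (-(n : ℤ) - (k : ℤ)) = 2 ^ (n - k) / 4 ^ n := by
    rw [show (4 : ℝ) = 2 ^ 2 by norm_num, ← pow_mul, ← zpow_natCast, ← zpow_natCast,
      ← zpow_sub₀ two_ne_zero]
    congr 1
    push_cast [Nat.cast_sub hkn]
    ring
  rw [hpow, Nat.cast_choose ℝ hkn]
  field_simp
end

section
/- Let λ > 0 be a real number. For every n ∈ ℕ and all real x, y, one has _HT_n(x+2, y:λ) + _HT_n(x, y:λ) = (2/(n+1)) · ( _H𝔅_{n+1}(x+1, y:λ) − _H𝔅_{n+1}(x, y:λ) ). -/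
open PowerSeries Finset

theorem expX_eq_rescale (a : ℝ) : expX a = rescale a (exp ℝ) := by
  ext n
  simp [expX, coeff_rescale, coeff_exp, div_eq_mul_inv]

theorem expH_add_left (a x y : ℝ) : expH (x + a) y = expX a * expH x y := by
  rw [expH, expH, expX_add]
  ring

theorem expX_add_one_ne_zero (a : ℝ) : expX a + 1 ≠ 0 := by
  intro h
  have h₀ := congrArg (coeff 0) h
  norm_num [expX] at h₀

/-- for λ > 0, `_HT_n(x+2,y:λ) + _HT_n(x,y:λ)
    = (2/(n+1)) (_H𝔅_{n+1}(x+1,y:λ) - _H𝔅_{n+1}(x,y:λ))`. -/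
theorem modified_degenerate_tangent_bernoulli_relation
    (l : ℝ) (hl : 0 < l)
    (T B : ℕ → ℝ → ℝ → ℝ)
    (hT : ∀ x y : ℝ,
      (PowerSeries.mk fun n => T n x y / n.factorial) * (expX (2 * Real.log (1 + l) / l) + 1)
        = 2 * expH (x * Real.log (1 + l) / l) (y * Real.log (1 + l) / l))
    (hB : ∀ x y : ℝ,
      (PowerSeries.mk fun n => B n x y / n.factorial) * (expX (Real.log (1 + l) / l) - 1)
        = PowerSeries.X * expH (x * Real.log (1 + l) / l) (y * Real.log (1 + l) / l))
    (n : ℕ) (x y : ℝ) :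
    T n (x + 2) y + T n x y =
      (2 / ((n : ℝ) + 1)) * (B (n + 1) (x + 1) y - B (n + 1) x y) := by
  have ha : Real.log (1 + l) / l ≠ 0 :=
    div_ne_zero (Real.log_pos (by linarith)).ne' hl.ne'
  set H := expH (x * Real.log (1 + l) / l) (y * Real.log (1 + l) / l) with hH
  have tangent_sum : (PowerSeries.mk fun n => T n (x + 2) y / n.factorial) +
      (PowerSeries.mk fun n => T n x y / n.factorial) = (2 : ℝ) • H := by
    apply mul_right_cancel₀ (expX_add_one_ne_zero (2 * Real.log (1 + l) / l))
    rw [add_mul, hT, hT, ← hH,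
      show (x + 2) * Real.log (1 + l) / l =
        x * Real.log (1 + l) / l + 2 * Real.log (1 + l) / l by ring,
      expH_add_left, ← hH, ofNat_smul_eq_nsmul, nsmul_eq_mul]
    push_cast
    ring
  have bernoulli_diff : (PowerSeries.mk fun n => B n (x + 1) y / n.factorial) -
      (PowerSeries.mk fun n => B n x y / n.factorial) = PowerSeries.X * H := by
    apply mul_right_cancel₀ (expX_sub_one_ne_zero ha)
    rw [sub_mul, hB, hB, ← hH,
      show (x + 1) * Real.log (1 + l) / l =
        x * Real.log (1 + l) / l + Real.log (1 + l) / l by ring,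
      expH_add_left, ← hH]
    ring
  have hTn := congrArg (coeff n) tangent_sum
  have hBn := congrArg (coeff (n + 1)) bernoulli_diff
  simp only [map_add, map_sub, coeff_mk, coeff_succ_X_mul, coeff_smul, smul_eq_mul] at hTn hBn
  have hn : (n.factorial : ℝ) ≠ 0 := by positivity
  have hn' : (n : ℝ) + 1 ≠ 0 := by positivity
  rw [← hBn, Nat.factorial_succ] at hTn
  push_cast at hTn
  field_simp at hTn ⊢
  linarith
end
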